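/- For every integer k ≥ 2 there exist a σ-finite measure space (X,μ) with μ nonatomic and μ(X) = ∞, an invertible measure-preserving conservative ergodic transformation T of (X,μ), and pairwise disjoint measurable sets S₀,…,S_{k−1}, each of positive measure, with X = S₀ ∪ ⋯ ∪ S_{k−1} up to a μ-null set and T(S_ℓ) = S_{(ℓ+1) mod k} up to a μ-null set for each ℓ, such that T is weak doubly ergodic on each piece: for each ℓ ∈ {0,…,k−1} and all measurable sets A, B ⊆ S_ℓ of positive measure there exists an integer n ≥ 1 with μ(A ∩ Tⁿ(A)) > 0 and μ(B ∩ Tⁿ(A)) > 0. (For k ≥ 2 such a T has a cyclic rotation on k points as a factor, hence is not weak mixing.) -/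

import Mathlib

open MeasureTheory Filter Set
open scoped ENNReal symmDiff

/-- `R` is conservative with respect to `ν`. -/
def IsConservative {Y : Type*} [MeasurableSpace Y] (ν : Measure Y) (R : Y → Y) : Prop :=
  ∀ A : Set Y, MeasurableSet A → 0 < ν A → ∃ n : ℕ, 1 ≤ n ∧ 0 < ν (A ∩ R^[n] ⁻¹' A)

/-- `R` is ergodic with respect to `ν`: invariant sets are null or conull. -/
def IsErgodicT {Y : Type*} [MeasurableSpace Y] (ν : Measure Y) (R : Y → Y) : Prop :=
  ∀ A : Set Y, MeasurableSet A → R ⁻¹' A = A → ν A = 0 ∨ ν Aᶜ = 0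

section Skyscraper

variable {Y : Type*} [MeasurableSpace Y]

/-- The transformation of `Y × ℕ` that climbs the tower `{(y, i) | i < h y}` over `y` one level at
a time, moves from its top to the bottom of the tower over `e y`, and fixes all points outside of
the towers. -/
def skyscraper (e : Y ≃ᵐ Y) (h : Y → ℕ) (hm : Measurable h) (hpos : ∀ y, 0 < h y) :
    Y × ℕ ≃ᵐ Y × ℕ where
  toFun q := if q.2 + 1 < h q.1 then (q.1, q.2 + 1)
    else if q.2 + 1 = h q.1 then (e q.1, 0) else q
  invFun q := if h q.1 ≤ q.2 then q
    else if q.2 = 0 then (e.symm q.1, h (e.symm q.1) - 1) else (q.1, q.2 - 1)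
  left_inv := by
    rintro ⟨y, i⟩
    have := hpos y
    have := hpos (e y)
    rcases lt_trichotomy (i + 1) (h y) with h1 | h1 | h1
    · simp [h1]
    · have h2 : i = h y - 1 := by omega
      have h3 : ¬ i + 1 < h y := by omega
      dsimp only
      rw [if_neg h3, if_pos h1, if_neg this.not_ge, if_pos rfl, e.symm_apply_apply, h2]
    · simp only [if_neg h1.not_gt, if_neg h1.ne', if_pos (Nat.lt_succ_iff.1 h1)]
  right_inv := by
    rintro ⟨y, i⟩
    have := hpos (e.symm y)
    rcases lt_or_ge i (h y) with h1 | h1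
    · rcases i with _ | i
      · simp [h1.not_ge, Nat.sub_add_cancel this]
      · simp [h1.not_ge, h1]
    · have h2 : ¬ i + 1 < h y := by omega
      have h3 : i + 1 ≠ h y := by omega
      simp [h1, h2, h3]
  measurable_toFun := by
    refine Measurable.ite (measurableSet_lt (by fun_prop) (by fun_prop)) (by fun_prop) ?_
    exact Measurable.ite (measurableSet_eq_fun (by fun_prop) (by fun_prop)) (by fun_prop)
      (by fun_prop)
  measurable_invFun := by
    refine Measurable.ite (measurableSet_le (by fun_prop) (by fun_prop)) (by fun_prop) ?_
    exact Measurable.ite (measurableSet_eq_fun (by fun_prop) (by fun_prop)) (by fun_prop)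
      (by fun_prop)

variable (e : Y ≃ᵐ Y) (h : Y → ℕ) (hm : Measurable h) (hpos : ∀ y, 0 < h y)

theorem skyscraper_of_lt {y : Y} {i : ℕ} (hi : i + 1 < h y) :
    skyscraper e h hm hpos (y, i) = (y, i + 1) :=
  if_pos hi

theorem skyscraper_of_eq {y : Y} {i : ℕ} (hi : i + 1 = h y) :
    skyscraper e h hm hpos (y, i) = (e y, 0) := by
  change ite _ _ _ = _
  rw [if_neg (by dsimp only; omega), if_pos hi]

theorem skyscraper_of_gt {y : Y} {i : ℕ} (hi : h y < i + 1) :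
    skyscraper e h hm hpos (y, i) = (y, i) := by
  change ite _ _ _ = _
  rw [if_neg (by dsimp only; omega), if_neg (by dsimp only; omega)]

theorem skyscraper_iterate_of_lt {y : Y} {i : ℕ} (hi : i < h y) :
    (skyscraper e h hm hpos)^[i] (y, 0) = (y, i) := by
  induction i with
  | zero => rfl
  | succ i ih => rw [Function.iterate_succ_apply', ih (by omega), skyscraper_of_lt _ _ _ _ hi]

theorem skyscraper_iterate_sum (y : Y) (j : ℕ) :
    (skyscraper e h hm hpos)^[∑ i ∈ Finset.range j, h (e^[i] y)] (y, 0) = (e^[j] y, 0) := by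
  induction j with
  | zero => rfl
  | succ j ih =>
    have h1 := hpos (e^[j] y)
    rw [Finset.sum_range_succ, add_comm, Function.iterate_add_apply, ih,
      ← Nat.sub_one_add_one h1.ne', Function.iterate_succ_apply',
      skyscraper_iterate_of_lt _ _ _ _ (by omega), skyscraper_of_eq _ _ _ _ (by omega),
      Function.iterate_succ_apply']

/-- The measure on the towers below the graph of `h`. -/
noncomputable def skyscraperMeasure (μ : Measure Y) (h : Y → ℕ) : Measure (Y × ℕ) :=
  (μ.prod Measure.count).restrict {q | q.2 < h q.1}

instance (μ : Measure Y) [SigmaFinite μ] : SigmaFinite (skyscraperMeasure μ h) := by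
  unfold skyscraperMeasure; infer_instance

variable {h}

include hm in
theorem measurableSet_under : MeasurableSet {q : Y × ℕ | q.2 < h q.1} :=
  measurableSet_lt (by fun_prop) (by fun_prop)

include hm in
theorem skyscraperMeasure_apply (μ : Measure Y) [SigmaFinite μ] {s : Set (Y × ℕ)}
    (hs : MeasurableSet s) :
    skyscraperMeasure μ h s = ∫⁻ y, ∑ i ∈ Finset.range (h y), s.indicator 1 (y, i) ∂μ := by
  rw [skyscraperMeasure, Measure.restrict_apply hs,
    Measure.prod_apply (hs.inter (measurableSet_under hm))]
  refine lintegral_congr fun y ↦ ?_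
  rw [← lintegral_indicator_one (measurable_prodMk_left (hs.inter (measurableSet_under hm))),
    lintegral_count, tsum_eq_sum (s := Finset.range (h y))]
  · refine Finset.sum_congr rfl fun i hi ↦ ?_
    by_cases h1 : (y, i) ∈ s <;> simp_all
  · intro i hi
    simp_all

theorem measurePreserving_skyscraper (μ : Measure Y) [SigmaFinite μ]
    (he : MeasurePreserving e μ μ) :
    MeasurePreserving (skyscraper e h hm hpos) (skyscraperMeasure μ h)
      (skyscraperMeasure μ h) := by
  refine ⟨(skyscraper e h hm hpos).measurable, Measure.ext fun s hs ↦ ?_⟩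
  rw [Measure.map_apply (skyscraper e h hm hpos).measurable hs, skyscraperMeasure_apply hm μ hs,
    skyscraperMeasure_apply hm μ ((skyscraper e h hm hpos).measurable hs)]
  have hs1 : Measurable (s.indicator (1 : Y × ℕ → ℝ≥0∞)) := measurable_one.indicator hs
  have h0 : Measurable fun y ↦ s.indicator (1 : Y × ℕ → ℝ≥0∞) (y, 0) := by fun_prop
  have key1 (y : Y) : ∑ i ∈ Finset.range (h y),
      ((skyscraper e h hm hpos) ⁻¹' s).indicator (1 : Y × ℕ → ℝ≥0∞) (y, i) =
      ∑ i ∈ Finset.range (h y - 1), s.indicator 1 (y, i + 1) + s.indicator 1 (e y, 0) := by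
    obtain ⟨n, hn⟩ := Nat.exists_eq_add_one.2 (hpos y)
    rw [hn, Finset.sum_range_succ]
    congr 1
    · refine Finset.sum_congr rfl fun i hi ↦ ?_
      rw [← skyscraper_of_lt e h hm hpos (by simp at hi; omega)]
      rfl
    · rw [← skyscraper_of_eq e h hm hpos hn.symm]
      rfl
  have key2 (y : Y) : ∑ i ∈ Finset.range (h y), s.indicator (1 : Y × ℕ → ℝ≥0∞) (y, i) =
      ∑ i ∈ Finset.range (h y - 1), s.indicator 1 (y, i + 1) + s.indicator 1 (y, 0) := by
    obtain ⟨n, hn⟩ := Nat.exists_eq_add_one.2 (hpos y)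
    rw [hn, Finset.sum_range_succ', Nat.add_sub_cancel]
  simp_rw [key1, key2]
  rw [lintegral_add_right _ (by fun_prop), lintegral_add_right _ h0]
  congr 1
  exact he.lintegral_comp h0

theorem skyscraperMeasure_prod_singleton (μ : Measure Y) [SigmaFinite μ] {s : Set Y} {i : ℕ}
    (hs : MeasurableSet s) (hsi : ∀ y ∈ s, i < h y) : skyscraperMeasure μ h (s ×ˢ {i}) = μ s := by
  rw [skyscraperMeasure, Measure.restrict_apply (hs.prod (measurableSet_singleton i)),
    inter_eq_self_of_subset_left, Measure.prod_prod, Measure.count_singleton, mul_one]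
  rintro ⟨y, j⟩ ⟨hy, rfl⟩
  exact hsi y hy

include hm in
theorem exists_slice_pos_of_skyscraperMeasure_pos (μ : Measure Y) [SigmaFinite μ]
    {s : Set (Y × ℕ)} (hs : MeasurableSet s) (h0 : 0 < skyscraperMeasure μ h s) :
    ∃ i : ℕ, MeasurableSet {y | (y, i) ∈ s ∧ i < h y} ∧ 0 < μ {y | (y, i) ∈ s ∧ i < h y} := by
  have hms (i : ℕ) : MeasurableSet {y | (y, i) ∈ s ∧ i < h y} :=
    measurable_prodMk_right (hs.inter (measurableSet_under hm))
  by_contra! hc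
  refine h0.ne' ?_
  rw [skyscraperMeasure, Measure.restrict_apply hs]
  have h2 : s ∩ {q | q.2 < h q.1} = ⋃ i : ℕ, {y | (y, i) ∈ s ∧ i < h y} ×ˢ {i} := by
    ext ⟨y, i⟩
    simp
  rw [h2, measure_iUnion_null_iff]
  intro i
  rw [Measure.prod_prod, le_antisymm (hc i (hms i)) zero_le, zero_mul]

end Skyscraper

section TriadicHeight

theorem not_three_dvd_add_three_mul {a : ℤ_[3]} (ha : a = 1 ∨ a = 2) (w : ℤ_[3]) :
    ¬ (3 : ℤ_[3]) ∣ a + 3 * w := by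
  rw [dvd_add_left (dvd_mul_right _ _)]
  have h := PadicInt.pow_p_dvd_int_iff (p := 3) 1
  rcases ha with rfl | rfl
  · have := (h 1).not.2 (by decide)
    simpa using this
  · have := (h 2).not.2 (by decide)
    simpa using this

theorem valuation_three_pow_mul {u : ℤ_[3]} (hu : ¬ (3 : ℤ_[3]) ∣ u) (v : ℕ) :
    (3 ^ v * u).valuation = v := by
  have hu0 : u ≠ 0 := by rintro rfl; simp at hu
  have h := PadicInt.valuation_p_pow_mul (p := 3) v u hu0
  have h1 : ¬ 1 ≤ u.valuation := by
    rw [← PadicInt.mem_span_pow_iff_le_valuation u hu0, Ideal.mem_span_singleton]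
    simpa using hu
  have h2 : u.valuation = 0 := by omega
  rw [h2] at h
  simpa using h

theorem exists_eq_add_three_mul (x : ℤ_[3]) :
    ∃ w, x = 3 * w ∨ x = 1 + 3 * w ∨ x = 2 + 3 * w := by
  obtain ⟨w, hw⟩ := Ideal.mem_span_singleton.1 (PadicInt.appr_spec 1 x)
  have h := PadicInt.appr_lt x 1
  rw [sub_eq_iff_eq_add'] at hw
  refine ⟨w, ?_⟩
  generalize x.appr 1 = r at hw h
  interval_cases r <;> simp_all

theorem exists_eq_three_pow_mul {x : ℤ_[3]} (hx : x ≠ 0) :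
    ∃ v w, x = 3 ^ v * (1 + 3 * w) ∨ x = 3 ^ v * (2 + 3 * w) := by
  have h1 := PadicInt.unitCoeff_spec hx
  have h2 : ¬ (3 : ℤ_[3]) ∣ PadicInt.unitCoeff hx := fun h ↦
    PadicInt.prime_p.not_isUnit (isUnit_of_dvd_unit (by exact_mod_cast h) (Units.isUnit _))
  obtain ⟨w, hw⟩ := exists_eq_add_three_mul (PadicInt.unitCoeff hx)
  have h0 : (PadicInt.unitCoeff hx : ℤ_[3]) ≠ 3 * w := fun h ↦ h2 ⟨w, h⟩
  refine ⟨x.valuation, w, ?_⟩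
  rw [mul_comm] at h1
  rcases hw with hw | hw | hw
  · exact absurd hw h0
  · rw [hw] at h1
    exact Or.inl (by simpa using h1)
  · rw [hw] at h1
    exact Or.inr (by simpa using h1)

open Classical in
/-- A function on the 3-adic integers that depends only on the position and the value of the
lowest nonzero digit: it is `k * M v` at `3 ^ v * (1 + 3 * w)` and `k * (M v + c v)` at
`3 ^ v * (2 + 3 * w)`. -/
noncomputable def triadicHeight (k : ℕ) (M c : ℕ → ℕ) (x : ℤ_[3]) : ℕ :=
  k * (M x.valuation + if ∃ v w, x = 3 ^ v * (2 + 3 * w) then c x.valuation else 0)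

variable (k : ℕ) (M c : ℕ → ℕ)

theorem dvd_triadicHeight (x : ℤ_[3]) : k ∣ triadicHeight k M c x :=
  dvd_mul_right _ _

theorem triadicHeight_pos (hk : 0 < k) (hM : ∀ v, 0 < M v) (x : ℤ_[3]) :
    0 < triadicHeight k M c x :=
  mul_pos hk (Nat.add_pos_left (hM _) _)

theorem triadicHeight_three_pow_mul_one_add (v : ℕ) (w : ℤ_[3]) :
    triadicHeight k M c (3 ^ v * (1 + 3 * w)) = k * M v := by
  have h1 := valuation_three_pow_mul (not_three_dvd_add_three_mul (Or.inl rfl) w) v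
  rw [triadicHeight, if_neg, h1, add_zero]
  rintro ⟨v', w', h⟩
  have h2 := valuation_three_pow_mul (not_three_dvd_add_three_mul (Or.inr rfl) w') v'
  rw [← h, h1] at h2
  subst h2
  have h3 : (1 + 3 * w : ℤ_[3]) = 2 + 3 * w' := mul_left_cancel₀ (by simp) h
  exact not_three_dvd_add_three_mul (Or.inl rfl) 0 ⟨w - w', by linear_combination -h3⟩

theorem triadicHeight_three_pow_mul_two_add (v : ℕ) (w : ℤ_[3]) :
    triadicHeight k M c (3 ^ v * (2 + 3 * w)) = k * (M v + c v) := by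
  rw [triadicHeight, if_pos ⟨v, w, rfl⟩,
    valuation_three_pow_mul (not_three_dvd_add_three_mul (Or.inr rfl) w) v]

theorem triadicHeight_add_three_pow_mul {N : ℕ} {x : ℤ_[3]} (hx : ¬ 3 ^ N ∣ x) (z : ℤ_[3]) :
    triadicHeight k M c (x + 3 ^ N * z) = triadicHeight k M c x := by
  have hx0 : x ≠ 0 := by rintro rfl; simp at hx
  obtain ⟨v, w, h⟩ := exists_eq_three_pow_mul hx0
  have hv : v < N := by
    by_contra! hv
    refine hx (dvd_trans (pow_dvd_pow 3 hv) ?_)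
    rcases h with rfl | rfl <;> exact dvd_mul_right _ _
  obtain ⟨d, rfl⟩ := Nat.exists_eq_add_of_lt hv
  rcases h with rfl | rfl
  · have h1 : (3 : ℤ_[3]) ^ v * (1 + 3 * w) + 3 ^ (v + d + 1) * z =
      3 ^ v * (1 + 3 * (w + 3 ^ d * z)) := by ring
    rw [h1, triadicHeight_three_pow_mul_one_add, triadicHeight_three_pow_mul_one_add]
  · have h1 : (3 : ℤ_[3]) ^ v * (2 + 3 * w) + 3 ^ (v + d + 1) * z =
      3 ^ v * (2 + 3 * (w + 3 ^ d * z)) := by ring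
    rw [h1, triadicHeight_three_pow_mul_two_add, triadicHeight_three_pow_mul_two_add]

theorem not_three_pow_dvd_natCast_succ {N r : ℕ} (hr : r + 1 < 3 ^ N) :
    ¬ (3 : ℤ_[3]) ^ N ∣ (r : ℤ_[3]) + 1 := by
  intro h
  have h1 := (PadicInt.pow_p_dvd_int_iff (p := 3) N (r + 1 : ℕ)).1 (by simpa using h)
  have h2 := Nat.le_of_dvd (Nat.succ_pos r) (by exact_mod_cast h1)
  omega

theorem sum_triadicHeight_add_natCast {N r : ℕ} (hr : r < 3 ^ N) (z : ℤ_[3]) :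
    ∑ i ∈ Finset.range (3 ^ N), triadicHeight k M c (r + 3 ^ N * z + i + 1) =
      ∑ i ∈ Finset.range (3 ^ N), triadicHeight k M c (3 ^ N * z + i + 1) := by
  induction r with
  | zero => simp
  | succ r ih =>
    rw [← ih (by omega)]
    have h1 := Finset.sum_range_succ
      (fun i : ℕ ↦ triadicHeight k M c (r + 3 ^ N * z + i + 1)) (3 ^ N)
    rw [Finset.sum_range_succ'] at h1
    have h2 : triadicHeight k M c (r + 3 ^ N * z + (3 ^ N : ℕ) + 1) =
        triadicHeight k M c (r + 3 ^ N * z + (0 : ℕ) + 1) := by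
      have h3 := not_three_pow_dvd_natCast_succ hr
      rw [← triadicHeight_add_three_pow_mul k M c (x := r + 3 ^ N * z + (0 : ℕ) + 1) (N := N)
        (z := 1)]
      · congr 1
        push_cast
        ring
      · intro h
        apply h3
        rw [← dvd_add_left (dvd_mul_right _ z)]
        convert h using 1
        push_cast
        ring
    rw [h2] at h1
    refine Eq.trans (Finset.sum_congr rfl fun i _ ↦ ?_) (Nat.add_right_cancel h1)
    congr 1
    push_cast
    ring

theorem sum_triadicHeight_three_pow_mul (N : ℕ) (z : ℤ_[3]) :
    ∑ i ∈ Finset.range (3 ^ N), triadicHeight k M c (3 ^ N * z + i + 1) =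
      ∑ i ∈ Finset.range (3 ^ N - 1), triadicHeight k M c (i + 1) +
        triadicHeight k M c (3 ^ N * (1 + z)) := by
  have h0 : 0 < 3 ^ N := by positivity
  rw [← Nat.sub_one_add_one h0.ne', Finset.sum_range_succ, Nat.add_sub_cancel]
  congr 1
  · refine Finset.sum_congr rfl fun i hi ↦ ?_
    rw [← triadicHeight_add_three_pow_mul k M c (z := z)
      (not_three_pow_dvd_natCast_succ (N := N) (r := i) (by simp at hi; omega))]
    congr 1
    ring
  · congr 1
    rw [Nat.cast_sub h0]
    push_cast
    ring

/-- The set of 3-adic integers whose digit at position `N` is `i` modulo 3. -/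
def triadicDigit (N i : ℕ) : Set ℤ_[3] :=
  {x | ∃ r : ℕ, r < 3 ^ N ∧ ∃ w, x = (r : ℤ_[3]) + 3 ^ N * (i + 3 * w)}

theorem triadicDigit_add_three (N i : ℕ) : triadicDigit N (i + 3) = triadicDigit N i := by
  ext x
  constructor
  · rintro ⟨r, hr, w, rfl⟩
    exact ⟨r, hr, w + 1, by push_cast; ring⟩
  · rintro ⟨r, hr, w, rfl⟩
    exact ⟨r, hr, w - 1, by push_cast; ring⟩

theorem triadicDigit_cover (N i : ℕ) (x : ℤ_[3]) :
    x ∈ triadicDigit N i ∨ x ∈ triadicDigit N (i + 1) ∨ x ∈ triadicDigit N (i + 2) := by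
  induction i with
  | succ i ih =>
    rw [show i + 1 + 2 = i + 3 from rfl, triadicDigit_add_three]
    tauto
  | zero =>
  obtain ⟨z, hz⟩ := Ideal.mem_span_singleton.1 (PadicInt.appr_spec N x)
  obtain ⟨w, hw⟩ := exists_eq_add_three_mul z
  rw [sub_eq_iff_eq_add'] at hz
  have hr := PadicInt.appr_lt x N
  rcases hw with rfl | rfl | rfl
  · exact Or.inl ⟨_, hr, w, by simpa using hz⟩
  · exact Or.inr (Or.inl ⟨_, hr, w, by simpa using hz⟩)
  · exact Or.inr (Or.inr ⟨_, hr, w, by simpa using hz⟩)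

theorem add_three_pow_mem_triadicDigit {N i : ℕ} {x : ℤ_[3]} (hx : x ∈ triadicDigit N i) :
    x + 3 ^ N ∈ triadicDigit N (i + 1) := by
  obtain ⟨r, hr, w, rfl⟩ := hx
  exact ⟨r, hr, w, by push_cast; ring⟩

theorem sum_triadicHeight_of_mem_triadicDigit_zero {N : ℕ} {x : ℤ_[3]}
    (hx : x ∈ triadicDigit N 0) :
    ∑ i ∈ Finset.range (3 ^ N), triadicHeight k M c (x + i + 1) =
      ∑ i ∈ Finset.range (3 ^ N - 1), triadicHeight k M c (i + 1) + k * M N := by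
  obtain ⟨r, hr, w, rfl⟩ := hx
  rw [sum_triadicHeight_add_natCast k M c hr, sum_triadicHeight_three_pow_mul,
    ← triadicHeight_three_pow_mul_one_add k M c N w]
  simp

theorem sum_triadicHeight_of_mem_triadicDigit_one {N : ℕ} {x : ℤ_[3]}
    (hx : x ∈ triadicDigit N 1) :
    ∑ i ∈ Finset.range (3 ^ N), triadicHeight k M c (x + i + 1) =
      ∑ i ∈ Finset.range (3 ^ N - 1), triadicHeight k M c (i + 1) + k * (M N + c N) := by
  obtain ⟨r, hr, w, rfl⟩ := hx
  rw [sum_triadicHeight_add_natCast k M c hr, sum_triadicHeight_three_pow_mul,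
    ← triadicHeight_three_pow_mul_two_add k M c N w]
  congr 2
  push_cast
  ring

theorem isClosed_range_affine (a b : ℤ_[3]) : IsClosed {x | ∃ w, x = a + b * w} := by
  have : {x | ∃ w, x = a + b * w} = range fun w ↦ a + b * w := by
    ext x; simp [eq_comm]
  rw [this]
  exact (isCompact_range (by fun_prop)).isClosed

theorem isOpen_range_affine (a : ℤ_[3]) (n : ℕ) : IsOpen {x | ∃ w, x = a + 3 ^ n * w} := by
  have : {x | ∃ w, x = a + 3 ^ n * w} = Metric.closedBall a ((3 : ℕ) ^ (-n : ℤ)) := by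
    ext x
    rw [Metric.mem_closedBall, dist_eq_norm, PadicInt.norm_le_pow_iff_mem_span_pow,
      Ideal.mem_span_singleton]
    simp only [dvd_def, sub_eq_iff_eq_add', mem_ofPred_eq, Nat.cast_ofNat]
  rw [this]
  exact IsUltrametricDist.isOpen_closedBall _ (by positivity)

theorem tendsto_three_pow : Tendsto (fun N : ℕ ↦ (3 : ℤ_[3]) ^ N) atTop (nhds 0) := by
  refine tendsto_pow_atTop_nhds_zero_of_norm_lt_one ?_
  have := PadicInt.norm_p (p := 3)
  rw [Nat.cast_ofNat] at this
  rw [this]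
  norm_num

variable [MeasurableSpace ℤ_[3]] [BorelSpace ℤ_[3]]

theorem measurable_valuation : Measurable (PadicInt.valuation : ℤ_[3] → ℕ) := by
  refine measurable_of_Ici fun n ↦ ?_
  rcases Nat.eq_zero_or_pos n with rfl | hn
  · simp
  have : PadicInt.valuation ⁻¹' Ici n = {x : ℤ_[3] | ∃ w, x = 0 + 3 ^ n * w} \ {0} := by
    ext x
    by_cases hx : x = 0
    · simp [hx]; omega
    · rw [mem_preimage, mem_Ici, ← PadicInt.mem_span_pow_iff_le_valuation x hx,
        Ideal.mem_span_singleton]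
      simp [hx, dvd_def]
  rw [this]
  exact (isClosed_range_affine _ _).measurableSet.diff (measurableSet_singleton 0)

theorem measurable_triadicHeight : Measurable (triadicHeight k M c) := by
  have hE : MeasurableSet {x : ℤ_[3] | ∃ v w, x = 3 ^ v * (2 + 3 * w)} := by
    have : {x : ℤ_[3] | ∃ v w, x = 3 ^ v * (2 + 3 * w)} =
        ⋃ v : ℕ, {x | ∃ w, x = (3 ^ v * 2 : ℤ_[3]) + (3 ^ v * 3) * w} := by
      ext x
      simp only [mem_ofPred_eq, mem_iUnion, mul_add, mul_assoc]
    rw [this]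
    exact .iUnion fun v ↦ (isClosed_range_affine _ _).measurableSet
  have hv (f : ℕ → ℕ) : Measurable fun x : ℤ_[3] ↦ f x.valuation :=
    (measurable_from_nat (f := f)).comp measurable_valuation
  exact ((hv M).add (Measurable.ite hE (hv c) measurable_const)).const_mul k

end TriadicHeight

section Haar

variable [MeasurableSpace ℤ_[3]] [BorelSpace ℤ_[3]] (μ : Measure ℤ_[3]) [μ.IsAddHaarMeasure]

theorem exists_natCast_add_mem_pos {A B : Set ℤ_[3]}
    (hB : MeasurableSet B) (hA0 : 0 < μ A) (hB0 : 0 < μ B) :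
    ∃ d : ℕ, 0 < μ {x | x ∈ A ∧ x + d ∈ B} := by
  have herg : Ergodic ((1 : ℤ_[3]) + ·) μ := by
    refine ergodic_add_left_of_denseRange_nsmul ?_ μ
    simpa using PadicInt.denseRange_natCast (p := 3)
  by_contra! hc
  set C : Set ℤ_[3] := ⋃ d : ℕ, {x | x + d ∈ B} with hC
  have hCm : MeasurableSet C := .iUnion fun d ↦ hB.preimage (measurable_add_const _)
  have hBC : B ⊆ C := fun x hx ↦ mem_iUnion.2 ⟨0, by simpa using hx⟩
  have hAC : μ (A ∩ C) = 0 := by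
    rw [hC, inter_iUnion, measure_iUnion_null_iff]
    exact fun d ↦ le_antisymm (hc d) zero_le
  have hinv : ((1 : ℤ_[3]) + ·) ⁻¹' C ⊆ C := by
    intro x hx
    obtain ⟨d, hd⟩ := mem_iUnion.1 hx
    refine mem_iUnion.2 ⟨d + 1, ?_⟩
    have h1 : 1 + x + d = x + (d + 1 : ℕ) := by push_cast; ring
    rw [mem_ofPred_eq, ← h1]
    exact hd
  rcases herg.ae_empty_or_univ_of_preimage_ae_le hCm.nullMeasurableSet
    hinv.eventuallyLE with h | h
  · exact (hB0.trans_le (measure_mono hBC)).ne' (by simpa using measure_congr h)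
  · refine hA0.ne' ?_
    rw [← hAC]
    have := (ae_eq_refl A).inter h
    rw [inter_univ] at this
    exact (measure_congr this).symm

theorem tendsto_measure_diff_add_three_pow {A : Set ℤ_[3]} (hA : MeasurableSet A) :
    Tendsto (fun N : ℕ ↦ μ {x | x ∈ A ∧ x + 3 ^ N ∉ A}) atTop (nhds 0) := by
  let F : C(ℤ_[3] × ℤ_[3], ℤ_[3]) := ⟨fun p ↦ p.2 + p.1, by fun_prop⟩
  have h1 : Tendsto (fun N : ℕ ↦ F.curry (3 ^ N)) atTop (nhds (F.curry 0)) :=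
    (F.curry.continuous.tendsto 0).comp tendsto_three_pow
  have hF (z : ℤ_[3]) : MeasurePreserving (F.curry z) μ μ := measurePreserving_add_right μ z
  have h2 := tendsto_measure_symmDiff_preimage_nhds_zero h1 (.of_forall fun _ ↦ hF _) (hF 0)
    hA.nullMeasurableSet (measure_ne_top μ A)
  refine tendsto_of_tendsto_of_tendsto_of_le_of_le tendsto_const_nhds h2 (fun _ ↦ zero_le)
    fun N ↦ measure_mono ?_
  rintro x ⟨hx, hx'⟩
  refine Or.inr ⟨?_, hx'⟩
  change x + 0 ∈ A
  simpa using hx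

theorem eventually_pos_of_triadicDigit {A : Set ℤ_[3]} (hA : MeasurableSet A) (hA0 : 0 < μ A) :
    ∀ᶠ N in atTop, ∀ i : ℕ, 0 < μ {x | x ∈ A ∧ x + 3 ^ N ∈ A ∧ x ∈ triadicDigit N i} := by
  have hε : 0 < μ A / 6 := ENNReal.div_pos hA0.ne' (by simp)
  filter_upwards [(tendsto_measure_diff_add_three_pow μ hA).eventually_lt_const hε] with N hN i
  set δ := μ {x | x ∈ A ∧ x + 3 ^ N ∉ A} with hδ
  by_contra! h0
  have hstep (j : ℕ) : μ (A ∩ triadicDigit N j) ≤ μ (A ∩ triadicDigit N (j + 1)) + δ := by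
    rw [← measure_preimage_add_right μ (3 ^ N) (A ∩ triadicDigit N (j + 1))]
    refine (measure_mono ?_).trans (measure_union_le _ _)
    rintro x ⟨hx, hxj⟩
    by_cases h : x + 3 ^ N ∈ A
    · exact Or.inl ⟨h, add_three_pow_mem_triadicDigit hxj⟩
    · exact Or.inr ⟨hx, h⟩
  have hi0 : μ (A ∩ triadicDigit N i) ≤ δ := by
    calc μ (A ∩ triadicDigit N i)
        ≤ μ {x | x ∈ A ∧ x + 3 ^ N ∈ A ∧ x ∈ triadicDigit N i} + δ := by
          refine (measure_mono ?_).trans (measure_union_le _ _)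
          rintro x ⟨hx, hxi⟩
          by_cases h : x + 3 ^ N ∈ A
          · exact Or.inl ⟨hx, h, hxi⟩
          · exact Or.inr ⟨hx, h⟩
      _ ≤ 0 + δ := by gcongr
      _ = δ := zero_add δ
  have hi2 : μ (A ∩ triadicDigit N (i + 2)) ≤ δ + δ := by
    refine (hstep (i + 2)).trans ?_
    rw [triadicDigit_add_three]
    gcongr
  have hi1 : μ (A ∩ triadicDigit N (i + 1)) ≤ δ + δ + δ := by
    refine (hstep (i + 1)).trans ?_
    gcongr
  have hcover : A ⊆ A ∩ triadicDigit N i ∪ A ∩ triadicDigit N (i + 1) ∪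
      A ∩ triadicDigit N (i + 2) := by
    intro x hx
    rcases triadicDigit_cover N i x with h | h | h
    · exact Or.inl (Or.inl ⟨hx, h⟩)
    · exact Or.inl (Or.inr ⟨hx, h⟩)
    · exact Or.inr ⟨hx, h⟩
  have hle : μ A ≤ 6 * δ := by
    calc μ A ≤ δ + (δ + δ + δ) + (δ + δ) :=
          (measure_mono hcover).trans <| (measure_union_le _ _).trans <|
            add_le_add ((measure_union_le _ _).trans (add_le_add hi0 hi1)) hi2
      _ = 6 * δ := by ring
  refine hle.not_gt ?_
  rw [mul_comm]
  exact (ENNReal.lt_div_iff_mul_lt (by simp) (by simp)).1 hN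

omit [BorelSpace ℤ_[3]] in
theorem exists_pos_and_le_mul_measure :
    ∃ M : ℕ → ℕ, (∀ v, 0 < M v) ∧
      ∀ v : ℕ, (v : ℝ≥0∞) ≤ M v * μ {x | ∃ w, x + 1 = 3 ^ v * (1 + 3 * w)} := by
  have hpos (v : ℕ) : 0 < μ {x | ∃ w, x + 1 = 3 ^ v * (1 + 3 * w)} := by
    have : {x : ℤ_[3] | ∃ w, x + 1 = 3 ^ v * (1 + 3 * w)} =
        {x | ∃ w, x = (3 ^ v - 1) + 3 ^ (v + 1) * w} := by
      ext x
      refine exists_congr fun w ↦ ⟨fun h ↦ by linear_combination h, fun h ↦ ?_⟩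
      linear_combination h
    rw [this]
    exact (isOpen_range_affine _ _).measure_pos μ ⟨_, 0, rfl⟩
  have (v : ℕ) : ∃ m : ℕ, 0 < m ∧
      (v : ℝ≥0∞) ≤ m * μ {x | ∃ w, x + 1 = 3 ^ v * (1 + 3 * w)} := by
    obtain ⟨m, hm⟩ := ENNReal.exists_nat_mul_gt (hpos v).ne' (ENNReal.natCast_ne_top v)
    refine ⟨m + 1, m.succ_pos, hm.le.trans ?_⟩
    gcongr
    simp
  choose M hM using this
  exact ⟨M, fun v ↦ (hM v).1, fun v ↦ (hM v).2⟩

end Haar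

section Tower

theorem iterate_mem_iff_of_preimage_eq {X : Type*} {f : X → X} {A : Set X} (h : f ⁻¹' A = A)
    (n : ℕ) (x : X) : f^[n] x ∈ A ↔ x ∈ A := by
  induction n with
  | zero => rfl
  | succ n ih => rw [Function.iterate_succ_apply', ← mem_preimage, h, ih]

variable (k : ℕ) (M c : ℕ → ℕ)

/-- The time the skyscraper transformation takes to move from the bottom of the tower over `x` to
the bottom of the tower over `x + j`. -/
noncomputable def travelTime (x : ℤ_[3]) (j : ℕ) : ℕ :=
  ∑ i ∈ Finset.range j, triadicHeight k M c (x + i + 1)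

theorem travelTime_add (x : ℤ_[3]) (i j : ℕ) :
    travelTime k M c x (i + j) = travelTime k M c x i + travelTime k M c (x + i) j := by
  simp only [travelTime, Finset.sum_range_add, Nat.cast_add, add_assoc]

theorem dvd_travelTime (x : ℤ_[3]) (j : ℕ) : k ∣ travelTime k M c x j :=
  Finset.dvd_sum fun _ _ ↦ dvd_triadicHeight k M c _

variable [MeasurableSpace ℤ_[3]] [BorelSpace ℤ_[3]]

theorem measurable_travelTime (j : ℕ) : Measurable fun x ↦ travelTime k M c x j :=
  Finset.measurable_fun_sum _ fun _ _ ↦ (measurable_triadicHeight k M c).comp (by fun_prop)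

theorem measurable_height : Measurable fun x ↦ triadicHeight k M c (x + 1) :=
  (measurable_triadicHeight k M c).comp (by fun_prop)

theorem measurableSet_return {A : Set ℤ_[3]} (hA : MeasurableSet A) (j n : ℕ) :
    MeasurableSet {x | x ∈ A ∧ x + j ∈ A ∧ travelTime k M c x j = n} :=
  hA.inter ((hA.preimage (measurable_add_const _)).inter
    (measurable_travelTime k M c j (measurableSet_singleton n)))

/-- The skyscraper over the 3-adic odometer whose height over `x` is `triadicHeight` at `x + 1`. -/
noncomputable def triadicTower (hk : 0 < k) (hM : ∀ v, 0 < M v) : ℤ_[3] × ℕ ≃ᵐ ℤ_[3] × ℕ :=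
  skyscraper (MeasurableEquiv.addRight 1) (fun x ↦ triadicHeight k M c (x + 1))
    (measurable_height k M c) fun _ ↦ triadicHeight_pos k M c hk hM _

variable {k M c} (hk : 0 < k) (hM : ∀ v, 0 < M v)

omit [BorelSpace ℤ_[3]] in
theorem addRight_one_iterate [MeasurableAdd ℤ_[3]] (x : ℤ_[3]) (j : ℕ) :
    (MeasurableEquiv.addRight (1 : ℤ_[3]))^[j] x = x + j := by
  induction j with
  | zero => simp
  | succ j ih =>
    rw [Function.iterate_succ_apply', ih]
    push_cast
    exact add_assoc _ _ _

theorem triadicTower_iterate_travelTime (x : ℤ_[3]) (j : ℕ) :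
    (triadicTower k M c hk hM)^[travelTime k M c x j] (x, 0) = (x + j, 0) := by
  have := skyscraper_iterate_sum (MeasurableEquiv.addRight 1)
    (fun x ↦ triadicHeight k M c (x + 1)) (measurable_height k M c)
    (fun _ ↦ triadicHeight_pos k M c hk hM _) x j
  simp only [addRight_one_iterate] at this
  exact this

theorem triadicTower_iterate_of_lt {x : ℤ_[3]} {a : ℕ} (ha : a < triadicHeight k M c (x + 1)) :
    (triadicTower k M c hk hM)^[a] (x, 0) = (x, a) :=
  skyscraper_iterate_of_lt _ _ _ _ ha

theorem triadicTower_iterate {x : ℤ_[3]} {a b j n : ℕ}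
    (ha : a < triadicHeight k M c (x + 1)) (hb : b < triadicHeight k M c (x + j + 1))
    (hn : n + a = travelTime k M c x j + b) :
    (triadicTower k M c hk hM)^[n] (x, a) = (x + j, b) := by
  rw [← triadicTower_iterate_of_lt hk hM ha, ← Function.iterate_add_apply, hn, add_comm,
    Function.iterate_add_apply, triadicTower_iterate_travelTime, triadicTower_iterate_of_lt hk hM hb]

/-- The level of a point of the tower increases by one modulo `k`. -/
theorem triadicTower_snd_mod {q : ℤ_[3] × ℕ} (hq : q.2 < triadicHeight k M c (q.1 + 1)) :
    (triadicTower k M c hk hM q).2 % k = (q.2 + 1) % k := by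
  obtain ⟨x, i⟩ := q
  rcases (Nat.succ_le_of_lt hq).lt_or_eq with h | h
  · have h1 : triadicTower k M c hk hM (x, i) = (x, i + 1) := skyscraper_of_lt _ _ _ _ h
    rw [h1]
  · have h1 : triadicTower k M c hk hM (x, i) = (x + 1, 0) := skyscraper_of_eq _ _ _ _ h
    rw [h1]
    have h2 : k ∣ i + 1 := (dvd_triadicHeight k M c (x + 1)).trans h.symm.dvd
    rw [Nat.zero_mod, Nat.mod_eq_zero_of_dvd h2]

theorem mem_tower_of_triadicTower_mem {q : ℤ_[3] × ℕ}
    (hq : (triadicTower k M c hk hM q).2 <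
      triadicHeight k M c ((triadicTower k M c hk hM q).1 + 1)) :
    q.2 < triadicHeight k M c (q.1 + 1) := by
  obtain ⟨x, i⟩ := q
  by_contra! h
  have h1 : triadicTower k M c hk hM (x, i) = (x, i) :=
    skyscraper_of_gt _ _ _ _ (Nat.lt_succ_of_le h)
  rw [h1] at hq
  exact absurd hq h.not_gt

variable (M c) (μ : Measure ℤ_[3]) [μ.IsAddHaarMeasure]

/-- The invariant measure of the tower. -/
noncomputable abbrev towerMeasure (k : ℕ) : Measure (ℤ_[3] × ℕ) :=
  skyscraperMeasure μ fun x ↦ triadicHeight k M c (x + 1)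

variable {M c}

theorem exists_return_times (hc : ∀ t, ∃ᶠ N in atTop, c N = t) (hk : 0 < k) (hM : ∀ v, 0 < M v)
    {A : Set ℤ_[3]} (hA : MeasurableSet A) (hA0 : 0 < μ A) {p q : ℕ} (hpq : p ≡ q [MOD k]) :
    ∃ n m j, 1 ≤ n ∧ n + p = m + q ∧
      0 < μ {x | x ∈ A ∧ x + (j : ℕ) ∈ A ∧ travelTime k M c x j = n} ∧
      0 < μ {x | x ∈ A ∧ x + (j : ℕ) ∈ A ∧ travelTime k M c x j = m} := by
  have key (t : ℕ) : ∃ n j, 1 ≤ n ∧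
      0 < μ {x | x ∈ A ∧ x + (j : ℕ) ∈ A ∧ travelTime k M c x j = n} ∧
      0 < μ {x | x ∈ A ∧ x + (j : ℕ) ∈ A ∧ travelTime k M c x j = n + k * t} := by
    obtain ⟨N, hN, hNt⟩ := ((eventually_pos_of_triadicDigit μ hA hA0).and_frequently (hc t)).exists
    refine ⟨∑ i ∈ Finset.range (3 ^ N - 1), triadicHeight k M c (i + 1) + k * M N, 3 ^ N,
      (Nat.mul_pos hk (hM N)).trans_le (Nat.le_add_left _ _), ?_, ?_⟩
    · refine (hN 0).trans_le (measure_mono ?_)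
      rintro x ⟨hx, hx', hxd⟩
      exact ⟨hx, by simpa using hx', sum_triadicHeight_of_mem_triadicDigit_zero k M c hxd⟩
    · refine (hN 1).trans_le (measure_mono ?_)
      rintro x ⟨hx, hx', hxd⟩
      refine ⟨hx, by simpa using hx', ?_⟩
      rw [travelTime, sum_triadicHeight_of_mem_triadicDigit_one k M c hxd, hNt, mul_add, add_assoc]
  rcases le_total p q with h | h
  · obtain ⟨t, ht⟩ := (Nat.modEq_iff_dvd' h).1 hpq
    obtain ⟨n, j, hn, h1, h2⟩ := key t
    exact ⟨n + k * t, n, j, by omega, by omega, h2, h1⟩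
  · obtain ⟨t, ht⟩ := (Nat.modEq_iff_dvd' h).1 hpq.symm
    obtain ⟨n, j, hn, h1, h2⟩ := key t
    exact ⟨n, n + k * t, j, hn, by omega, h1, h2⟩

omit [BorelSpace ℤ_[3]] in
theorem towerMeasure_pos {E : Set ℤ_[3]} (hE : MeasurableSet E) (hE0 : 0 < μ E) {i : ℕ}
    {F : Set (ℤ_[3] × ℕ)} (hF : ∀ x ∈ E, i < triadicHeight k M c (x + 1) ∧ (x, i) ∈ F) :
    0 < towerMeasure M c μ k F := by
  rw [← skyscraperMeasure_prod_singleton (h := fun x ↦ triadicHeight k M c (x + 1)) (i := i) μ hE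
    fun x hx ↦ (hF x hx).1] at hE0
  refine hE0.trans_le (measure_mono ?_)
  rintro ⟨x, j⟩ ⟨hx, rfl⟩
  exact (hF x hx).2

theorem exists_slice_pos {A : Set (ℤ_[3] × ℕ)} (hA : MeasurableSet A)
    (hA0 : 0 < towerMeasure M c μ k A) :
    ∃ a, MeasurableSet {x | (x, a) ∈ A ∧ a < triadicHeight k M c (x + 1)} ∧
      0 < μ {x | (x, a) ∈ A ∧ a < triadicHeight k M c (x + 1)} :=
  exists_slice_pos_of_skyscraperMeasure_pos (measurable_height k M c) μ hA hA0

theorem isConservative_triadicTower (hc : ∀ t, ∃ᶠ N in atTop, c N = t) :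
    IsConservative (towerMeasure M c μ k) (triadicTower k M c hk hM) := by
  intro A hA hA0
  obtain ⟨a, hm, h0⟩ := exists_slice_pos μ hA hA0
  obtain ⟨n, -, j, hn, -, h1, -⟩ := exists_return_times μ hc hk hM hm h0 (Nat.ModEq.refl 0)
  refine ⟨n, hn, towerMeasure_pos μ (measurableSet_return k M c hm j n) h1 (i := a) ?_⟩
  rintro x ⟨⟨hx, hxa⟩, ⟨hx', hxa'⟩, hxn⟩
  refine ⟨hxa, hx, ?_⟩
  rw [mem_preimage, triadicTower_iterate hk hM hxa hxa' (by rw [hxn])]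
  exact hx'

theorem isErgodicT_triadicTower :
    IsErgodicT (towerMeasure M c μ k) (triadicTower k M c hk hM) := by
  intro A hA hinv
  by_contra! h
  obtain ⟨a, hma, ha⟩ := exists_slice_pos μ hA (pos_iff_ne_zero.2 h.1)
  obtain ⟨b, hmb, hb⟩ := exists_slice_pos μ hA.compl (pos_iff_ne_zero.2 h.2)
  obtain ⟨d, hd⟩ := exists_natCast_add_mem_pos μ hmb ha hb
  obtain ⟨x, ⟨hx, hxa⟩, hx', hxb⟩ := nonempty_of_measure_ne_zero hd.ne'
  have h1 := iterate_mem_iff_of_preimage_eq hinv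
  refine hx' ?_
  rw [← triadicTower_iterate_of_lt hk hM hxb, h1, ← triadicTower_iterate_travelTime hk hM, h1,
    ← h1 a, triadicTower_iterate_of_lt hk hM hxa]
  exact hx

theorem exists_pos_inter_image_iterate (hc : ∀ t, ∃ᶠ N in atTop, c N = t)
    {A B : Set (ℤ_[3] × ℕ)} (hA : MeasurableSet A) (hB : MeasurableSet B)
    (hA0 : 0 < towerMeasure M c μ k A) (hB0 : 0 < towerMeasure M c μ k B)
    (hAB : ∀ p ∈ A, ∀ q ∈ B, p.2 ≡ q.2 [MOD k]) :
    ∃ n : ℕ, 1 ≤ n ∧ 0 < towerMeasure M c μ k (A ∩ (triadicTower k M c hk hM)^[n] '' A) ∧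
      0 < towerMeasure M c μ k (B ∩ (triadicTower k M c hk hM)^[n] '' A) := by
  obtain ⟨a, hma, ha⟩ := exists_slice_pos μ hA hA0
  obtain ⟨b, hmb, hb⟩ := exists_slice_pos μ hB hB0
  obtain ⟨d, hd⟩ := exists_natCast_add_mem_pos μ hmb ha hb
  set C := {x | x ∈ {x | (x, a) ∈ A ∧ a < triadicHeight k M c (x + 1)} ∧
    x + d ∈ {x | (x, b) ∈ B ∧ b < triadicHeight k M c (x + 1)}} with hC
  have hCm : MeasurableSet C := hma.inter (hmb.preimage (measurable_add_const _))
  obtain ⟨s, hs⟩ : ∃ s, 0 < μ (C ∩ {x | travelTime k M c x d = s}) := by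
    by_contra! h
    refine hd.ne' ?_
    have hU : C = ⋃ s, C ∩ {x | travelTime k M c x d = s} := by
      ext x
      simp
    rw [hU, measure_iUnion_null_iff]
    exact fun s ↦ le_antisymm (h s) zero_le
  have hDm : MeasurableSet (C ∩ {x | travelTime k M c x d = s}) :=
    hCm.inter (measurable_travelTime k M c d (measurableSet_singleton s))
  obtain ⟨x₀, ⟨⟨hx₀, -⟩, hx₀', -⟩, hx₀s⟩ := nonempty_of_measure_ne_zero hs.ne'
  have hab : a ≡ s + b [MOD k] := by
    have h1 : s ≡ 0 [MOD k] :=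
      (Nat.modEq_zero_iff_dvd).2 (hx₀s ▸ dvd_travelTime k M c x₀ d)
    have h2 : a ≡ b [MOD k] := hAB _ hx₀ _ hx₀'
    simpa using h2.trans (by simpa using h1.symm.add_right b)
  obtain ⟨n, m, j, hn, hnm, h1, h2⟩ := exists_return_times μ hc hk hM hDm hs hab
  have hmove {E : Set ℤ_[3]} (hE : MeasurableSet E) (hE0 : 0 < μ E) (y : ℤ_[3]) :
      MeasurableSet ((· - y) ⁻¹' E) ∧ 0 < μ ((· - y) ⁻¹' E) := by
    refine ⟨hE.preimage (measurable_sub_const _), ?_⟩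
    simp only [sub_eq_add_neg]
    rwa [measure_preimage_add_right]
  refine ⟨n, hn, ?_, ?_⟩
  · obtain ⟨h3, h4⟩ := hmove (measurableSet_return k M c hDm j n) h1 j
    refine towerMeasure_pos μ h3 h4 (i := a) ?_
    intro y hy
    obtain ⟨x, rfl⟩ : ∃ x, y = x + j := ⟨y - j, by simp⟩
    rw [mem_preimage, add_sub_cancel_right] at hy
    obtain ⟨⟨⟨⟨hx, hxa⟩, -⟩, -⟩, ⟨⟨⟨hx', hxa'⟩, -⟩, -⟩, hxn⟩ := hy
    exact ⟨hxa', hx', _, hx, triadicTower_iterate hk hM hxa hxa' (by rw [hxn])⟩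
  · obtain ⟨h3, h4⟩ := hmove (measurableSet_return k M c hDm j m) h2 (j + d : ℕ)
    refine towerMeasure_pos μ h3 h4 (i := b) ?_
    intro y hy
    obtain ⟨x, rfl⟩ : ∃ x, y = x + (j + d : ℕ) := ⟨y - (j + d : ℕ), by simp⟩
    rw [mem_preimage, add_sub_cancel_right] at hy
    obtain ⟨⟨⟨⟨hx, hxa⟩, -⟩, -⟩, ⟨⟨-, hxb, hxb'⟩, hxs⟩, hxm⟩ := hy
    have hjd : x + j + d = x + (j + d : ℕ) := by push_cast; ring
    rw [hjd] at hxb hxb'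
    refine ⟨hxb', hxb, _, hx, triadicTower_iterate hk hM hxa hxb' ?_⟩
    rw [mem_ofPred_eq] at hxs
    rw [travelTime_add, hxm, hxs, hnm, add_assoc]

omit [BorelSpace ℤ_[3]] [μ.IsAddHaarMeasure] in
theorem towerMeasure_univ (hk : 0 < k)
    (hMμ : ∀ v : ℕ, (v : ℝ≥0∞) ≤ M v * μ {x | ∃ w, x + 1 = 3 ^ v * (1 + 3 * w)}) :
    towerMeasure M c μ k univ = ∞ := by
  refine ENNReal.eq_top_of_forall_nnreal_le fun r ↦ ?_
  obtain ⟨v, hv⟩ := exists_nat_ge r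
  calc (r : ℝ≥0∞) ≤ v := by exact_mod_cast hv
    _ ≤ M v * μ {x | ∃ w, x + 1 = 3 ^ v * (1 + 3 * w)} := hMμ v
    _ = (μ.prod Measure.count) ({x | ∃ w, x + 1 = 3 ^ v * (1 + 3 * w)} ×ˢ Iio (M v)) := by
      rw [Measure.prod_prod, mul_comm]
      congr 1
      rw [← Finset.coe_Iio, Measure.count_apply_finset]
      simp
    _ ≤ towerMeasure M c μ k univ := by
      rw [towerMeasure, skyscraperMeasure, Measure.restrict_apply_univ]
      refine measure_mono ?_
      rintro ⟨x, i⟩ ⟨⟨w, hw⟩, hi⟩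
      change i < triadicHeight k M c (x + 1)
      rw [hw, triadicHeight_three_pow_mul_one_add]
      exact (mem_Iio.1 hi).trans_le (Nat.le_mul_of_pos_left _ hk)

omit [BorelSpace ℤ_[3]] in
theorem towerMeasure_level_pos (hM : ∀ v, 0 < M v) {i : ℕ} (hi : i < k) :
    0 < towerMeasure M c μ k {q | q.2 % k = i} := by
  refine towerMeasure_pos μ MeasurableSet.univ (isOpen_univ.measure_pos μ univ_nonempty) (i := i)
    fun x _ ↦ ⟨?_, Nat.mod_eq_of_lt hi⟩
  exact hi.trans_le (Nat.le_of_dvd (triadicHeight_pos k M c (by omega) hM _)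
    (dvd_triadicHeight k M c _))

omit [μ.IsAddHaarMeasure] in
theorem towerMeasure_image_symmDiff {i : ℕ} (hi : i < k) :
    towerMeasure M c μ k ((triadicTower k M c hk hM '' {q | q.2 % k = i}) ∆
      {q | q.2 % k = (i + 1) % k}) = 0 := by
  have hsub : (triadicTower k M c hk hM '' {q | q.2 % k = i}) ∆ {q | q.2 % k = (i + 1) % k} ⊆
      {q | q.2 < triadicHeight k M c (q.1 + 1)}ᶜ := by
    intro p hp hpt
    obtain ⟨q, rfl⟩ := (triadicTower k M c hk hM).surjective p
    have h1 := triadicTower_snd_mod hk hM (mem_tower_of_triadicTower_mem hk hM hpt)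
    have h2 : q.2 % k = i ↔ (q.2 + 1) % k = (i + 1) % k := by
      conv_lhs => rw [← Nat.mod_eq_of_lt hi]
      exact ⟨fun h ↦ Nat.ModEq.add_right 1 h, fun h ↦ Nat.ModEq.add_right_cancel' 1 h⟩
    rw [mem_symmDiff, (triadicTower k M c hk hM).injective.mem_set_image, mem_ofPred_eq,
      mem_ofPred_eq, h1, h2] at hp
    tauto
  refine measure_mono_null hsub ?_
  rw [towerMeasure, skyscraperMeasure,
    Measure.restrict_apply (measurableSet_under (measurable_height k M c)).compl, compl_inter_self,
    measure_empty]

theorem towerMeasure_singleton (q : ℤ_[3] × ℕ) : towerMeasure M c μ k {q} = 0 := by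
  obtain ⟨x, i⟩ := q
  refine nonpos_iff_eq_zero.1 ((Measure.restrict_apply_le _ _).trans ?_)
  have : (nhdsWithin (0 : ℤ_[3]) {0}ᶜ).NeBot :=
    (tendsto_nhdsWithin_iff.2 ⟨tendsto_three_pow, .of_forall fun N ↦ by simp⟩).neBot
  rw [← singleton_prod_singleton, Measure.prod_prod, measure_singleton, zero_mul]

end Tower

/-- For every `k ≥ 2` there is an invertible measure-preserving conservative ergodic
transformation of an infinite nonatomic σ-finite measure space with a measurable partition
`S₀,…,S_{k−1}` (up to a null set), cyclically permuted by `T` (up to null sets), such that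
`T` is weak doubly ergodic on each piece `S_ℓ`. -/
theorem exists_wde_on_partition (k : ℕ) (hk : 2 ≤ k) :
    ∃ (X : Type) (_ : MeasurableSpace X) (μ : Measure X) (_ : SigmaFinite μ)
      (T : X ≃ᵐ X) (S : Fin k → Set X),
      (∀ x : X, μ {x} = 0) ∧ μ Set.univ = ∞ ∧
      MeasurePreserving T μ μ ∧
      IsConservative μ T ∧ IsErgodicT μ T ∧
      (∀ i, MeasurableSet (S i)) ∧ (∀ i, 0 < μ (S i)) ∧
      (∀ i j, i ≠ j → S i ∩ S j = ∅) ∧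
      μ ((⋃ i, S i)ᶜ) = 0 ∧
      (∀ i : Fin k, μ ((⇑T '' S i) ∆ S ⟨((i : ℕ) + 1) % k, Nat.mod_lt _ (by omega)⟩) = 0) ∧
      (∀ i : Fin k, ∀ A B : Set X, A ⊆ S i → B ⊆ S i →
        MeasurableSet A → MeasurableSet B → 0 < μ A → 0 < μ B →
        ∃ n : ℕ, 1 ≤ n ∧ 0 < μ (A ∩ (⇑T)^[n] '' A) ∧ 0 < μ (B ∩ (⇑T)^[n] '' A)) := by
  borelize ℤ_[3]
  let μ : Measure ℤ_[3] := Measure.addHaar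
  have hk0 : 0 < k := by omega
  obtain ⟨M, hM, hMμ⟩ := exists_pos_and_le_mul_measure μ
  let c : ℕ → ℕ := fun N ↦ (Nat.unpair N).1
  have hc (t : ℕ) : ∃ᶠ N in atTop, c N = t :=
    frequently_atTop.2 fun a ↦ ⟨Nat.pair t a, Nat.right_le_pair t a, by simp [c]⟩
  refine ⟨ℤ_[3] × ℕ, inferInstance, towerMeasure M c μ k, inferInstance,
    triadicTower k M c hk0 hM, fun i ↦ {q | q.2 % k = i}, towerMeasure_singleton μ,
    towerMeasure_univ μ hk0 hMμ,
    measurePreserving_skyscraper _ _ _ _ (measurePreserving_add_right μ 1),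
    isConservative_triadicTower hk0 hM μ hc, isErgodicT_triadicTower hk0 hM μ, ?_,
    fun i ↦ towerMeasure_level_pos μ hM i.2, ?_, ?_,
    fun i ↦ towerMeasure_image_symmDiff hk0 hM μ i.2, ?_⟩
  · exact fun i ↦ measurable_snd (MeasurableSet.of_discrete (s := {n : ℕ | n % k = i}))
  · intro i j hij
    refine disjoint_iff_inter_eq_empty.1 (disjoint_left.2 fun q hi hj ↦ hij (Fin.ext ?_))
    exact hi.symm.trans hj
  · have : (⋃ i : Fin k, {q : ℤ_[3] × ℕ | q.2 % k = i}) = univ :=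
      eq_univ_of_forall fun q ↦ mem_iUnion.2 ⟨⟨q.2 % k, Nat.mod_lt _ hk0⟩, rfl⟩
    rw [this, compl_univ, measure_empty]
  · intro i A B hAS hBS hA hB hA0 hB0
    exact exists_pos_inter_image_iterate hk0 hM μ hc hA hB hA0 hB0
      fun p hp q hq ↦ (hAS hp).trans (hBS hq).symm
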